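/- Let (V, ω) be a symplectic vector space and let L1, L2, L−, L+ be Lagrangian subspaces such that L1 is transverse to L2, L− is transverse to L2, and L+ is transverse to L1. If L− ≻_{L2} L1 (with respect to the polarization (L1, L2)) and L+ ≻_{L1} L2 (with respect to (L2, L1)), then L+ is transverse to L2 and L− ≻_{L2} L+ (with respect to the polarization (L+, L2)). -/

import Mathlib

open Module

variable {V : Type*} [AddCommGroup V] [Module ℝ V]

/-- The `ω`-orthogonal complement of a subspace `W`:
`W^⊥ = {v ∈ V : ω(v, x) = 0 for all x ∈ W}`. -/
def SympOrtho (ω : V →ₗ[ℝ] V →ₗ[ℝ] ℝ) (W : Submodule ℝ V) : Submodule ℝ V :=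
  ⨅ x ∈ W, LinearMap.ker (ω.flip x)

/-- A symplectic form: a nondegenerate alternating bilinear form. -/
def IsSymplectic (ω : V →ₗ[ℝ] V →ₗ[ℝ] ℝ) : Prop :=
  (∀ v : V, (∀ w : V, ω v w = 0) → v = 0) ∧ ∀ v : V, ω v v = 0

/-- A subspace is Lagrangian if it equals its `ω`-orthogonal complement. -/
def IsLagrangian (ω : V →ₗ[ℝ] V →ₗ[ℝ] ℝ) (L : Submodule ℝ V) : Prop :=
  SympOrtho ω L = L

/-- `PosRel ω X Y Z` says `X ≻_Z Y` (with respect to the polarization `(Y, Z)`):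
for every nonzero `x ∈ Y` and every `m ∈ Z` with `x + m ∈ X` (such an `m` exists and
is unique since `V = X ⊕ Z`), one has `ω(m, x) > 0`; i.e. the quadratic form
`X^{(Y,Z)}` is positive definite. -/
def PosRel (ω : V →ₗ[ℝ] V →ₗ[ℝ] ℝ) (X Y Z : Submodule ℝ V) : Prop :=
  ∀ x ∈ Y, x ≠ 0 → ∀ m ∈ Z, x + m ∈ X → 0 < ω m x

/-- `NegRel ω X Y Z` says `X ≺_Z Y`: the quadratic form `X^{(Y,Z)}` is negative
definite. -/
def NegRel (ω : V →ₗ[ℝ] V →ₗ[ℝ] ℝ) (X Y Z : Submodule ℝ V) : Prop :=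
  ∀ x ∈ Y, x ≠ 0 → ∀ m ∈ Z, x + m ∈ X → ω m x < 0

theorem mem_sympOrtho {ω : V →ₗ[ℝ] V →ₗ[ℝ] ℝ} {W : Submodule ℝ V} {v : V} :
    v ∈ SympOrtho ω W ↔ ∀ x ∈ W, ω v x = 0 := by
  simp [SympOrtho, Submodule.mem_iInf]

theorem IsLagrangian.apply_eq_zero {ω : V →ₗ[ℝ] V →ₗ[ℝ] ℝ} {L : Submodule ℝ V}
    (hL : IsLagrangian ω L) {x y : V} (hx : x ∈ L) (hy : y ∈ L) : ω x y = 0 := by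
  rw [← hL] at hx
  exact mem_sympOrtho.1 hx y hy

/-- In a symplectic vector space a subspace with trivial orthogonal complement is everything. -/
theorem IsSymplectic.eq_top_of_sympOrtho_eq_bot [FiniteDimensional ℝ V]
    {ω : V →ₗ[ℝ] V →ₗ[ℝ] ℝ} (hω : IsSymplectic ω) {W : Submodule ℝ V}
    (hW : SympOrtho ω W = ⊥) : W = ⊤ := by
  by_contra hne
  obtain ⟨f, hf, hWf⟩ := W.exists_le_ker_of_lt_top (lt_top_iff_ne_top.2 hne)
  have hinj : Function.Injective ω := by
    refine (injective_iff_map_eq_zero ω).2 fun v hv => hω.1 v fun w => ?_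
    rw [hv, LinearMap.zero_apply]
  obtain ⟨v, rfl⟩ := (LinearMap.injective_iff_surjective_of_finrank_eq_finrank
    (Subspace.dual_finrank_eq (K := ℝ) (V := V)).symm).1 hinj f
  have hv : v ∈ SympOrtho ω W := mem_sympOrtho.2 fun x hx => hWf hx
  rw [hW, Submodule.mem_bot] at hv
  exact hf (by rw [hv, map_zero])

/-- Transverse Lagrangian subspaces span the whole space. -/
theorem IsLagrangian.sup_eq_top [FiniteDimensional ℝ V]
    {ω : V →ₗ[ℝ] V →ₗ[ℝ] ℝ} (hω : IsSymplectic ω) {L M : Submodule ℝ V}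
    (hL : IsLagrangian ω L) (hM : IsLagrangian ω M) (hLM : L ⊓ M = ⊥) : L ⊔ M = ⊤ := by
  refine hω.eq_top_of_sympOrtho_eq_bot (eq_bot_iff.2 fun v hv => ?_)
  rw [mem_sympOrtho] at hv
  rw [← hLM]
  constructor
  · rw [← hL]
    exact mem_sympOrtho.2 fun x hx => hv x (Submodule.mem_sup_left hx)
  · rw [← hM]
    exact mem_sympOrtho.2 fun x hx => hv x (Submodule.mem_sup_right hx)

/-- If `X ≻_Z Y`, then `X` is transverse to `Y`. -/
theorem PosRel.inf_eq_bot {ω : V →ₗ[ℝ] V →ₗ[ℝ] ℝ} {X Y Z : Submodule ℝ V}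
    (h : PosRel ω X Y Z) : X ⊓ Y = ⊥ := by
  refine (Submodule.eq_bot_iff _).2 fun x hx => ?_
  by_contra hne
  have := h x hx.2 hne 0 Z.zero_mem (by simpa using hx.1)
  simp at this

/-- Let L1, L2, L−, L+ be Lagrangian subspaces with L1 transverse to L2, L− transverse
to L2, and L+ transverse to L1. If L− ≻_{L2} L1 (w.r.t. (L1, L2)) and L+ ≻_{L1} L2
(w.r.t. (L2, L1)), then L+ is transverse to L2 and L− ≻_{L2} L+ (w.r.t. (L+, L2)). -/
theorem lagrangian_pos_between [FiniteDimensional ℝ V]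
    (ω : V →ₗ[ℝ] V →ₗ[ℝ] ℝ) (hω : IsSymplectic ω)
    (L₁ L₂ Lm Lp : Submodule ℝ V)
    (hL₁ : IsLagrangian ω L₁) (hL₂ : IsLagrangian ω L₂)
    (hLm : IsLagrangian ω Lm) (hLp : IsLagrangian ω Lp)
    (h12 : L₁ ⊓ L₂ = ⊥) (hm2 : Lm ⊓ L₂ = ⊥) (hp1 : Lp ⊓ L₁ = ⊥)
    (hm : PosRel ω Lm L₁ L₂) (hp : PosRel ω Lp L₂ L₁) :
    Lp ⊓ L₂ = ⊥ ∧ PosRel ω Lm Lp L₂ := by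
  have hp2 : Lp ⊓ L₂ = ⊥ := hp.inf_eq_bot
  refine ⟨hp2, fun x hx hx0 m hm₂ hxm => ?_⟩
  have hx_top : x ∈ L₁ ⊔ L₂ := by
    rw [hL₁.sup_eq_top hω hL₂ h12]
    exact Submodule.mem_top
  obtain ⟨a, ha, b, hb, rfl⟩ := Submodule.mem_sup.1 hx_top
  have ha0 : a ≠ 0 := by
    rintro rfl
    rw [zero_add] at hx hx0
    exact hx0 ((Submodule.eq_bot_iff _).1 hp2 b ⟨hx, hb⟩)
  have hb0 : b ≠ 0 := by
    rintro rfl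
    rw [add_zero] at hx hx0
    exact hx0 ((Submodule.eq_bot_iff _).1 hp1 a ⟨hx, ha⟩)
  have h₁ := hm a ha ha0 (b + m) (L₂.add_mem hb hm₂) (by rwa [← add_assoc])
  have h₂ := hp b hb hb0 a ha (by rwa [add_comm])
  have hmb : ω m b = 0 := hL₂.apply_eq_zero hm₂ hb
  have hskew : -ω a b = ω b a := LinearMap.IsAlt.neg hω.2 a b
  rw [map_add, LinearMap.add_apply] at h₁
  rw [map_add]
  linarith
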